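/- Suppose m distinct points x_1,…,x_m ∈ ℝ^s and Y = [y_j^k] ∈ ℝ^{t×m} are given, λ > 0, the loss function Q : ℝ^{t×m} → [0,∞) is lower semi-continuous, and D_{X,Y} ≠ {0}. Then there exists a solution f̂ of the regularization problem inf{Q(I_X(f_μ) − Y) + λ‖f_μ‖_{B_N} : f_μ ∈ B_N} of the form f̂(x) = Σ_{ℓ=1}^{tm} γ_ℓ · sign(ĝ(θ_ℓ)) · K(x, θ_ℓ) for all x ∈ ℝ^s, for some nonzero ĝ ∈ V_N, some γ_1,…,γ_{tm} ∈ ℝ with Σ_{ℓ=1}^{tm} γ_ℓ = ‖ĝ‖_∞, and some θ_1,…,θ_{tm} ∈ Θ(ĝ). -/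

import Mathlib

open MeasureTheory Filter Topology
open scoped ZeroAtInfty BigOperators

noncomputable section

/-- The parameter space of a depth-`D` deep neural network with layer widths
`m 0, m 1, …, m D` (input dimension `m 0 = s`, output dimension `m D = t`). -/
abbrev Params (m : ℕ → ℕ) (D : ℕ) : Type :=
  (j : Fin D) → ((Fin (m (j.1 + 1)) → Fin (m j.1) → ℝ) × (Fin (m (j.1 + 1)) → ℝ))

/-- The deep neural network `N(x, θ)` of depth `D`, defined recursively by
`N¹(x) = W₁ x + b₁` and `N^{j+1}(x) = W_{j+1} σ(N^j(x)) + b_{j+1}`. -/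
def NNet (σ : ℝ → ℝ) (m : ℕ → ℕ) :
    (D : ℕ) → Params m D → (Fin (m 0) → ℝ) → Fin (m D) → ℝ
  | 0, _, x => x
  | 1, θ, x => fun i => (∑ k, (θ ⟨0, Nat.one_pos⟩).1 i k * x k) + (θ ⟨0, Nat.one_pos⟩).2 i
  | (D + 2), θ, x => fun i =>
      (∑ k, (θ (Fin.last (D + 1))).1 i k *
          σ (NNet σ m (D + 1) (fun j => θ j.castSucc) x k))
        + (θ (Fin.last (D + 1))).2 i

/-- The integral of a function against a finite signed (Radon) measure,
via the Jordan decomposition. -/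
def sInt {Θ : Type*} [MeasurableSpace Θ] (μ : SignedMeasure Θ) (f : Θ → ℝ) : ℝ :=
  (∫ θ, f θ ∂μ.toJordanDecomposition.posPart) - ∫ θ, f θ ∂μ.toJordanDecomposition.negPart

/-- The total variation norm of a signed measure. -/
def tvNorm {Θ : Type*} [MeasurableSpace Θ] (μ : SignedMeasure Θ) : ℝ :=
  (μ.totalVariation Set.univ).toReal

/-- `f_μ^k(x) := ∫_Θ N_k(x,θ) ρ(θ) dμ(θ)`. -/
def fMu (σ : ℝ → ℝ) (m : ℕ → ℕ) (D : ℕ) (ρ : Params m D → ℝ)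
    (μ : SignedMeasure (Params m D)) : (Fin (m 0) → ℝ) → Fin (m D) → ℝ :=
  fun x k => sInt μ fun θ => NNet σ m D θ x k * ρ θ

/-- The set `B_N = {f_μ : μ ∈ M(Θ)}`. -/
def BNset (σ : ℝ → ℝ) (m : ℕ → ℕ) (D : ℕ) (ρ : Params m D → ℝ) :
    Set ((Fin (m 0) → ℝ) → Fin (m D) → ℝ) :=
  {f | ∃ μ : SignedMeasure (Params m D), fMu σ m D ρ μ = f}

/-- The norm `‖f‖_{B_N} = inf {‖ν‖_TV : f_ν = f}`. -/
def BNnorm (σ : ℝ → ℝ) (m : ℕ → ℕ) (D : ℕ) (ρ : Params m D → ℝ)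
    (f : (Fin (m 0) → ℝ) → Fin (m D) → ℝ) : ℝ :=
  sInf (tvNorm '' {ν : SignedMeasure (Params m D) | fMu σ m D ρ ν = f})

/-- `S`: the closed linear span in `C₀(Θ)` of the functions `θ ↦ N_k(x,θ)ρ(θ)`
(given here as the bundled family `Kb`). -/
def Sspan (m : ℕ → ℕ) (D : ℕ)
    (Kb : (Fin (m 0) → ℝ) → Fin (m D) → C₀(Params m D, ℝ)) :
    Submodule ℝ C₀(Params m D, ℝ) :=
  (Submodule.span ℝ
    (Set.range fun p : (Fin (m 0) → ℝ) × Fin (m D) => Kb p.1 p.2)).topologicalClosure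

/-- `V_N := span {K_k(x_j, ·) : j, k}`. -/
def VN (m : ℕ → ℕ) (D : ℕ)
    (Kb : (Fin (m 0) → ℝ) → Fin (m D) → C₀(Params m D, ℝ))
    (M : ℕ) (x : Fin M → (Fin (m 0) → ℝ)) : Submodule ℝ C₀(Params m D, ℝ) :=
  Submodule.span ℝ (Set.range fun p : Fin (m D) × Fin M => Kb (x p.2) p.1)

/-- The interpolation condition `f(x_j) = y_j`, i.e. `f_k(x_j) = y_j^k` for all `j, k`. -/
def interpolates (m : ℕ → ℕ) (D : ℕ) (M : ℕ) (x : Fin M → (Fin (m 0) → ℝ))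
    (Y : Fin (m D) → Fin M → ℝ) (f : (Fin (m 0) → ℝ) → Fin (m D) → ℝ) : Prop :=
  ∀ (j : Fin M) (k : Fin (m D)), f (x j) k = Y k j

/-- The solution set `S_{X,Y}` of the MNI problem
`inf {‖f‖_{B_N} : f ∈ B_N, f(x_j) = y_j}`. -/
def MNISolSet (σ : ℝ → ℝ) (m : ℕ → ℕ) (D : ℕ) (ρ : Params m D → ℝ)
    (M : ℕ) (x : Fin M → (Fin (m 0) → ℝ)) (Y : Fin (m D) → Fin M → ℝ) :
    Set ((Fin (m 0) → ℝ) → Fin (m D) → ℝ) :=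
  {f | f ∈ BNset σ m D ρ ∧ interpolates m D M x Y f ∧
    ∀ μ : SignedMeasure (Params m D), interpolates m D M x Y (fMu σ m D ρ μ) →
      BNnorm σ m D ρ f ≤ BNnorm σ m D ρ (fMu σ m D ρ μ)}

/-- The solution set of the measure MNI problem
`inf {‖μ‖_TV : μ ∈ M(Θ), ∫ K_k(x_j,·) dμ = y_j^k}`. -/
def MeasSolSet (σ : ℝ → ℝ) (m : ℕ → ℕ) (D : ℕ) (ρ : Params m D → ℝ)
    (M : ℕ) (x : Fin M → (Fin (m 0) → ℝ)) (Y : Fin (m D) → Fin M → ℝ) :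
    Set (SignedMeasure (Params m D)) :=
  {μ | interpolates m D M x Y (fMu σ m D ρ μ) ∧
    ∀ ν : SignedMeasure (Params m D), interpolates m D M x Y (fMu σ m D ρ ν) →
      tvNorm μ ≤ tvNorm ν}

/-- The subdifferential `∂‖·‖_∞(g) ⊆ B_N` of the supremum norm at `g ∈ S`, viewing `B_N`
as the dual of `S` via the (representation independent) pairing `⟨f_μ, g⟩ = ∫ g dμ`:
`∂‖·‖_∞(g) = {f_μ ∈ B_N : ‖f_μ‖_{B_N} = 1, ∫ g dμ = ‖g‖_∞}`. -/
def subdiffSup (σ : ℝ → ℝ) (m : ℕ → ℕ) (D : ℕ) (ρ : Params m D → ℝ)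
    (g : C₀(Params m D, ℝ)) : Set ((Fin (m 0) → ℝ) → Fin (m D) → ℝ) :=
  {f | f ∈ BNset σ m D ρ ∧ BNnorm σ m D ρ f = 1 ∧
    ∀ μ : SignedMeasure (Params m D), fMu σ m D ρ μ = f → sInt μ (fun θ => g θ) = ‖g‖}

/-- Feasibility for the dual problem: `‖∑_{k,j} c_{kj} K_k(x_j,·)‖_∞ = 1`. -/
def dualFeasible (m : ℕ → ℕ) (D : ℕ)
    (Kb : (Fin (m 0) → ℝ) → Fin (m D) → C₀(Params m D, ℝ))
    (M : ℕ) (x : Fin M → (Fin (m 0) → ℝ)) (c : Fin (m D) → Fin M → ℝ) : Prop :=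
  ‖∑ k, ∑ j, c k j • Kb (x j) k‖ = 1

/-- The objective `∑_{k,j} c_{kj} y_j^k` of the dual problem. -/
def dualObjective (m : ℕ → ℕ) (D : ℕ) (M : ℕ) (Y : Fin (m D) → Fin M → ℝ)
    (c : Fin (m D) → Fin M → ℝ) : ℝ :=
  ∑ k, ∑ j, c k j * Y k j

/-- `c` is a solution of the dual problem. -/
def dualSolves (m : ℕ → ℕ) (D : ℕ)
    (Kb : (Fin (m 0) → ℝ) → Fin (m D) → C₀(Params m D, ℝ))
    (M : ℕ) (x : Fin M → (Fin (m 0) → ℝ)) (Y : Fin (m D) → Fin M → ℝ)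
    (c : Fin (m D) → Fin M → ℝ) : Prop :=
  dualFeasible m D Kb M x c ∧
    ∀ c' : Fin (m D) → Fin M → ℝ, dualFeasible m D Kb M x c' →
      dualObjective m D M Y c' ≤ dualObjective m D M Y c

/-- `ĝ := C* · ∑_{k,j} ĉ_{kj} K_k(x_j,·)`, where `C*` is the optimal dual value
(the value of the dual objective at the dual solution `c`). -/
def ghat (m : ℕ → ℕ) (D : ℕ)
    (Kb : (Fin (m 0) → ℝ) → Fin (m D) → C₀(Params m D, ℝ))
    (M : ℕ) (x : Fin M → (Fin (m 0) → ℝ)) (Y : Fin (m D) → Fin M → ℝ)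
    (c : Fin (m D) → Fin M → ℝ) : C₀(Params m D, ℝ) :=
  dualObjective m D M Y c • ∑ k, ∑ j, c k j • Kb (x j) k

/-- `Θ(g) := {θ ∈ Θ : |g(θ)| = ‖g‖_∞}`. -/
def ThetaSet (m : ℕ → ℕ) (D : ℕ) (g : C₀(Params m D, ℝ)) : Set (Params m D) :=
  {θ | |g θ| = ‖g‖}

/-- The regularization objective `Q(I_X(f) − Y) + λ ‖f‖_{B_N}`. -/
def regObj (σ : ℝ → ℝ) (m : ℕ → ℕ) (D : ℕ) (ρ : Params m D → ℝ)
    (M : ℕ) (x : Fin M → (Fin (m 0) → ℝ)) (Y : Fin (m D) → Fin M → ℝ)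
    (lam : ℝ) (Q : (Fin (m D) → Fin M → ℝ) → ℝ)
    (f : (Fin (m 0) → ℝ) → Fin (m D) → ℝ) : ℝ :=
  Q ((fun k j => f (x j) k) - Y) + lam * BNnorm σ m D ρ f

/-- The solution set `R_{X,Y}` of the regularization problem. -/
def RegSolSet (σ : ℝ → ℝ) (m : ℕ → ℕ) (D : ℕ) (ρ : Params m D → ℝ)
    (M : ℕ) (x : Fin M → (Fin (m 0) → ℝ)) (Y : Fin (m D) → Fin M → ℝ)
    (lam : ℝ) (Q : (Fin (m D) → Fin M → ℝ) → ℝ) :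
    Set ((Fin (m 0) → ℝ) → Fin (m D) → ℝ) :=
  {f | f ∈ BNset σ m D ρ ∧
    ∀ μ : SignedMeasure (Params m D),
      regObj σ m D ρ M x Y lam Q f ≤ regObj σ m D ρ M x Y lam Q (fMu σ m D ρ μ)}

/-- `D_{X,Y} := I_X(R_{X,Y})`. -/
def DXY (σ : ℝ → ℝ) (m : ℕ → ℕ) (D : ℕ) (ρ : Params m D → ℝ)
    (M : ℕ) (x : Fin M → (Fin (m 0) → ℝ)) (Y : Fin (m D) → Fin M → ℝ)
    (lam : ℝ) (Q : (Fin (m D) → Fin M → ℝ) → ℝ) : Set (Fin (m D) → Fin M → ℝ) :=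
  (fun f => fun k j => f (x j) k) '' RegSolSet σ m D ρ M x Y lam Q

theorem IsCompact.convexHull_of_finiteDimensional {E : Type*} [NormedAddCommGroup E]
    [NormedSpace ℝ E] [FiniteDimensional ℝ E] {s : Set E} (hs : IsCompact s) :
    IsCompact (convexHull ℝ s) := by
  have key : convexHull ℝ s = ⋃ n ∈ Set.Iic (Module.finrank ℝ E + 1),
      (fun p : (Fin n → ℝ) × (Fin n → E) => ∑ i, p.1 i • p.2 i) ''
        (stdSimplex ℝ (Fin n) ×ˢ Set.univ.pi fun _ => s) := by
    apply Set.Subset.antisymm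
    · intro y hy
      obtain ⟨ι, _, z, w, hz, hind, hw, hw1, rfl⟩ := eq_pos_convex_span_of_mem_convexHull hy
      let e := Fintype.equivFin ι
      refine Set.mem_biUnion (x := Fintype.card ι)
        (hind.card_le_finrank_succ.trans (by gcongr; exact Submodule.finrank_le _)) ?_
      refine ⟨(w ∘ e.symm, z ∘ e.symm), ⟨⟨fun i => (hw _).le, ?_⟩, fun i _ => hz ⟨_, rfl⟩⟩, ?_⟩
      · simpa using (e.symm.sum_comp w).trans hw1
      · exact e.symm.sum_comp fun i => w i • z i
    · refine Set.iUnion₂_subset fun n _ => ?_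
      rintro _ ⟨⟨w, z⟩, ⟨⟨hw, hw1⟩, hz⟩, rfl⟩
      exact (convex_convexHull ℝ s).sum_mem (fun i _ => hw i) hw1
        fun i _ => subset_convexHull ℝ s (hz i trivial)
  rw [key]
  refine (Set.finite_Iic _).isCompact_biUnion fun n _ => ?_
  exact ((isCompact_stdSimplex ℝ (Fin n)).prod (isCompact_univ_pi fun _ => hs)).image
    (by fun_prop)

/-- The absolutely convex hull of the feature vectors `(K i θ)_i`, `θ ∈ Θ`. -/
def featureHull {Θ ι : Type*} [TopologicalSpace Θ] (K : ι → C₀(Θ, ℝ)) : Set (ι → ℝ) :=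
  convexHull ℝ {z | ∃ ε ∈ Set.Icc (-1 : ℝ) 1, ∃ θ, z = ε • fun i => K i θ}

section featureHull

open scoped Pointwise

variable {Θ ι : Type*} [TopologicalSpace Θ] (K : ι → C₀(Θ, ℝ))

theorem convex_featureHull : Convex ℝ (featureHull K) := convex_convexHull ℝ _

theorem smul_mem_featureHull {ε : ℝ} (hε : |ε| ≤ 1) (θ : Θ) :
    (ε • fun i => K i θ) ∈ featureHull K :=
  subset_convexHull ℝ _ ⟨ε, abs_le.1 hε, θ, rfl⟩

theorem zero_mem_featureHull [Nonempty Θ] : (0 : ι → ℝ) ∈ featureHull K := by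
  simpa using smul_mem_featureHull K (ε := 0) (by simp) (Classical.arbitrary Θ)

theorem isCompact_featureHull [Nonempty Θ] [Fintype ι] : IsCompact (featureHull K) := by
  apply IsCompact.convexHull_of_finiteDimensional
  have hκ : IsCompact (insert 0 (Set.range fun θ i => K i θ)) :=
    Tendsto.isCompact_insert_range_of_cocompact
      (tendsto_pi_nhds.2 fun i => (K i).zero_at_infty')
      (continuous_pi fun i => (K i).continuous)
  have himg := ((isCompact_Icc (a := (-1 : ℝ)) (b := 1)).prod hκ).image
    (f := fun p : ℝ × (ι → ℝ) => p.1 • p.2) (by fun_prop)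
  refine (congrArg IsCompact (Set.ext fun z => ?_)).mpr himg
  constructor
  · rintro ⟨ε, hε, θ, rfl⟩
    exact ⟨(ε, _), ⟨hε, Or.inr ⟨θ, rfl⟩⟩, rfl⟩
  · rintro ⟨⟨ε, v⟩, ⟨hε, hv⟩, rfl⟩
    rcases hv with hv | ⟨θ, rfl⟩
    · refine ⟨0, by simp, Classical.arbitrary Θ, ?_⟩
      simp only at hv
      simp [hv]
    · exact ⟨ε, hε, θ, rfl⟩

theorem neg_mem_featureHull {z : ι → ℝ} (hz : z ∈ featureHull K) :
    -z ∈ featureHull K := by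
  have h : -featureHull K = featureHull K := by
    rw [featureHull, ← convexHull_neg]
    congr 1
    ext y
    constructor
    · rintro ⟨ε, hε, θ, h⟩
      exact ⟨-ε, ⟨by linarith [hε.2], by linarith [hε.1]⟩, θ, by rw [neg_smul, ← h, neg_neg]⟩
    · rintro ⟨ε, hε, θ, rfl⟩
      exact ⟨-ε, ⟨by linarith [hε.2], by linarith [hε.1]⟩, θ, by rw [neg_smul]⟩
  rw [← h]
  simpa using hz

end featureHull

section SignedMeasure

open scoped Pointwise

variable {Θ : Type*} [MeasurableSpace Θ]

theorem sInt_toSignedMeasure_sub (μ ν : Measure Θ) [IsFiniteMeasure μ] [IsFiniteMeasure ν]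
    {f : Θ → ℝ} (hf : Measurable f) {C : ℝ} (hC : ∀ θ, |f θ| ≤ C) :
    sInt (μ.toSignedMeasure - ν.toSignedMeasure) f = ∫ θ, f θ ∂μ - ∫ θ, f θ ∂ν := by
  set s := μ.toSignedMeasure - ν.toSignedMeasure with hs
  have hint : ∀ (τ : Measure Θ) [IsFiniteMeasure τ], Integrable f τ := fun τ _ =>
    Integrable.of_bound hf.aestronglyMeasurable C (Eventually.of_forall hC)
  have hsum : s.toJordanDecomposition.posPart + ν = s.toJordanDecomposition.negPart + μ := by
    ext A hA
    have h := s.apply_eq_posPart_real_sub_negPart_real hA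
    rw [hs, Measure.toSignedMeasure_sub_apply hA, ← hs] at h
    rw [← measureReal_eq_measureReal_iff, measureReal_add_apply, measureReal_add_apply]
    linarith
  have h := congrArg (fun τ => ∫ θ, f θ ∂τ) hsum
  simp only [integral_add_measure (hint _) (hint _)] at h
  rw [sInt]
  linarith

theorem tvNorm_toSignedMeasure_sub_le (μ ν : Measure Θ) [IsFiniteMeasure μ] [IsFiniteMeasure ν] :
    tvNorm (μ.toSignedMeasure - ν.toSignedMeasure) ≤ μ.real Set.univ + ν.real Set.univ := by
  rw [tvNorm, SignedMeasure.totalVariation_eq_variation, sub_eq_add_neg, ← measureReal_add_apply]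
  refine ENNReal.toReal_mono (measure_ne_top _ _) ?_
  have h := VectorMeasure.variation_add_le (μ := μ.toSignedMeasure) (ν := -ν.toSignedMeasure)
  rw [VectorMeasure.variation_neg, Measure.variation_toSignedMeasure,
    Measure.variation_toSignedMeasure] at h
  exact h _

theorem exists_signedMeasure_sum_dirac {J : Type*} [Fintype J] (a : J → ℝ) (p : J → Θ) :
    ∃ μ : SignedMeasure Θ, tvNorm μ ≤ ∑ j, |a j| ∧
      ∀ f : Θ → ℝ, Measurable f → (∃ C, ∀ θ, |f θ| ≤ C) → sInt μ f = ∑ j, a j * f (p j) := by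
  let μ (b : J → ℝ) : Measure Θ := ∑ j, ENNReal.ofReal (b j) • Measure.dirac (p j)
  have hfin : ∀ b, IsFiniteMeasure (μ b) := fun b => ⟨by simp [μ, ENNReal.sum_lt_top]⟩
  have hreal : ∀ b, (μ b).real Set.univ = ∑ j, max (b j) 0 := fun b => by
    simp [μ, Measure.real, ENNReal.toReal_sum, ENNReal.toReal_ofReal']
  refine ⟨(μ a).toSignedMeasure - (μ (-a)).toSignedMeasure, ?_, fun f hf ⟨C, hC⟩ => ?_⟩
  · refine (tvNorm_toSignedMeasure_sub_le _ _).trans_eq ?_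
    rw [hreal, hreal, ← Finset.sum_add_distrib]
    refine Finset.sum_congr rfl fun j _ => ?_
    rcases le_total 0 (a j) with h | h <;> simp [h, abs_of_nonneg, abs_of_nonpos]
  · have hint : ∀ b, ∫ θ, f θ ∂μ b = ∑ j, max (b j) 0 * f (p j) := fun b => by
      rw [integral_finsetSum_measure fun j _ =>
        (Integrable.of_bound (μ := Measure.dirac (p j)) hf.aestronglyMeasurable C
          (Eventually.of_forall hC)).smul_measure ENNReal.ofReal_ne_top]
      simp [integral_smul_measure, integral_dirac' _ _ hf.stronglyMeasurable,
        ENNReal.toReal_ofReal']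
    rw [sInt_toSignedMeasure_sub _ _ hf hC, hint, hint, ← Finset.sum_sub_distrib]
    refine Finset.sum_congr rfl fun j _ => ?_
    rw [← sub_mul]
    rcases le_total 0 (a j) with h | h <;> simp [h]

variable [TopologicalSpace Θ] [OpensMeasurableSpace Θ] [Nonempty Θ] {ι : Type*} [Fintype ι]

theorem integral_mem_smul_featureHull (K : ι → C₀(Θ, ℝ)) (ν : Measure Θ) [IsFiniteMeasure ν] :
    (fun i => ∫ θ, K i θ ∂ν) ∈ ν.real Set.univ • featureHull K := by
  rcases eq_or_ne ν 0 with rfl | hν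
  · exact ⟨0, zero_mem_featureHull K, by ext; simp⟩
  have : NeZero ν := ⟨hν⟩
  have hint : ∀ i, Integrable (fun θ => K i θ) ν := fun i =>
    Integrable.of_bound (K i).continuous.measurable.aestronglyMeasurable ‖K i‖
      (Eventually.of_forall fun θ => (K i).toBCF.norm_coe_le_norm θ)
  refine ⟨⨍ θ, (fun i => K i θ) ∂ν, (convex_featureHull K).average_mem
    (isCompact_featureHull K).isClosed (Eventually.of_forall fun θ => ?_)
    (Integrable.of_eval hint), ?_⟩
  · simpa using smul_mem_featureHull K (ε := 1) (by simp) θ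
  · simp only [measure_smul_average]
    exact funext fun i => eval_integral hint i

theorem sInt_mem_smul_featureHull (K : ι → C₀(Θ, ℝ)) (μ : SignedMeasure Θ) :
    (fun i => sInt μ (K i)) ∈ tvNorm μ • featureHull K := by
  have htv : tvNorm μ = μ.toJordanDecomposition.posPart.real Set.univ +
      μ.toJordanDecomposition.negPart.real Set.univ :=
    measureReal_add_apply
  rw [htv, (convex_featureHull K).add_smul measureReal_nonneg measureReal_nonneg]
  obtain ⟨c, hc, hc'⟩ := integral_mem_smul_featureHull K μ.toJordanDecomposition.negPart
  refine ⟨_, integral_mem_smul_featureHull K μ.toJordanDecomposition.posPart, _,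
    ⟨-c, neg_mem_featureHull K hc, rfl⟩, ?_⟩
  ext i
  have := congrFun hc' i
  simp only [Pi.smul_apply, Pi.add_apply, Pi.neg_apply, smul_eq_mul, sInt] at this ⊢
  linarith

end SignedMeasure

section PeakFunction

open scoped Pointwise

variable {Θ : Type*} [TopologicalSpace Θ]

theorem ZeroAtInftyContinuousMap.sum_smul_apply {ι : Type*} [Fintype ι] (a : ι → ℝ)
    (K : ι → C₀(Θ, ℝ)) (θ : Θ) : (∑ i, a i • K i) θ = ∑ i, a i * K i θ := by
  let ev : C₀(Θ, ℝ) →+ ℝ :=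
    { toFun := fun g => g θ, map_zero' := rfl, map_add' := fun _ _ => rfl }
  exact map_sum ev _ _

theorem ZeroAtInftyContinuousMap.abs_apply_le_norm (g : C₀(Θ, ℝ)) (θ : Θ) : |g θ| ≤ ‖g‖ :=
  g.toBCF.norm_coe_le_norm θ

theorem ZeroAtInftyContinuousMap.norm_le_of_forall_abs_le [Nonempty Θ] {g : C₀(Θ, ℝ)} {C : ℝ}
    (h : ∀ θ, |g θ| ≤ C) : ‖g‖ ≤ C := by
  rw [← ZeroAtInftyContinuousMap.norm_toBCF_eq_norm, BoundedContinuousFunction.norm_le_of_nonempty]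
  exact h

/-- A point of the feature hull that lies in none of its proper dilates is exposed by a
function of norm one in the span of the features, and is a convex combination of at most
`card ι` signed feature vectors at peaks of that function. -/
theorem exists_peak_function [Nonempty Θ] {ι κ : Type*} [Fintype ι] [Fintype κ]
    (hκ : Fintype.card κ = Fintype.card ι) (K : ι → C₀(Θ, ℝ)) {c : ι → ℝ}
    (hc : c ∈ featureHull K) (hmin : ∀ s : ℝ, 0 ≤ s → s < 1 → c ∉ s • featureHull K) :
    ∃ g ∈ Submodule.span ℝ (Set.range K), ‖g‖ = 1 ∧ ∃ (w : κ → ℝ) (θ : κ → Θ),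
      (∀ j, 0 ≤ w j) ∧ ∑ j, w j = 1 ∧ (∀ j, |g (θ j)| = 1) ∧
      ∀ i, ∑ j, w j * Real.sign (g (θ j)) * K i (θ j) = c i := by
  classical
  obtain ⟨J, _, z, w, hz, hind, hw, hw1, hc⟩ := eq_pos_convex_span_of_mem_convexHull hc
  choose ε hε θ hzθ using fun j => hz ⟨j, rfl⟩
  let L : C₀(Θ, ℝ) →ₗ[ℝ] ℝ :=
    { toFun := fun g => ∑ j, w j * (ε j * g (θ j))
      map_add' := fun g h => by simp [mul_add, Finset.sum_add_distrib]
      map_smul' := fun a g => by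
        simp only [ZeroAtInftyContinuousMap.smul_apply, smul_eq_mul, RingHom.id_apply,
          Finset.mul_sum]
        exact Finset.sum_congr rfl fun j _ => by ring }
  have hL : ∀ g, L g = ∑ j, w j * (ε j * g (θ j)) := fun _ => rfl
  have hεg : ∀ (g : C₀(Θ, ℝ)) j, ‖g‖ ≤ 1 → ε j * g (θ j) ≤ 1 := fun g j hg => by
    refine (le_abs_self _).trans ?_
    rw [abs_mul]
    exact mul_le_one₀ (abs_le.2 (hε j)) (abs_nonneg _) ((g.abs_apply_le_norm _).trans hg)
  let V := Submodule.span ℝ (Set.range K)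
  have : FiniteDimensional ℝ V := FiniteDimensional.span_of_finite ℝ (Set.finite_range K)
  have : ProperSpace V := FiniteDimensional.proper_real V
  obtain ⟨⟨g, hgV⟩, hg1, hgmax⟩ := (isCompact_closedBall (0 : V) 1).exists_isMaxOn
    ⟨0, by simp⟩ (LinearMap.continuous_of_finiteDimensional (L ∘ₗ V.subtype)).continuousOn
  replace hg1 : ‖g‖ ≤ 1 := mem_closedBall_zero_iff.1 hg1
  replace hgmax : ∀ h ∈ V, ‖h‖ ≤ 1 → L h ≤ L g := fun h hh h1 =>
    hgmax (show (⟨h, hh⟩ : V) ∈ _ from mem_closedBall_zero_iff.2 h1)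
  have hs0 : 0 ≤ L g := by simpa using hgmax 0 V.zero_mem (by simp)
  have hLle : ∀ h ∈ V, L h ≤ L g * ‖h‖ := fun h hh => by
    rcases eq_or_ne h 0 with rfl | h0
    · simp
    have hpos := norm_pos_iff.2 h0
    have := hgmax (‖h‖⁻¹ • h) (V.smul_mem _ hh) (by simp [norm_smul, hpos.ne'])
    rwa [map_smul, smul_eq_mul, inv_mul_le_iff₀ hpos, mul_comm] at this
  have hmem : c ∈ L g • featureHull K := by
    by_contra hcon
    obtain ⟨f, u, hfu, huc⟩ := geometric_hahn_banach_closed_point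
      ((convex_featureHull K).smul (L g)) ((isCompact_featureHull K).smul (L g)).isClosed hcon
    let h : C₀(Θ, ℝ) := ∑ i, f (Pi.single i 1) • K i
    have hhV : h ∈ V := V.sum_mem fun i _ => V.smul_mem _ (Submodule.subset_span ⟨i, rfl⟩)
    have hh : ∀ θ, h θ = f fun i => K i θ := fun θ => by
      rw [ZeroAtInftyContinuousMap.sum_smul_apply]
      refine Eq.trans ?_
        (LinearMap.pi_apply_eq_sum_univ (f : (ι → ℝ) →ₗ[ℝ] ℝ) fun i => K i θ).symm
      refine Finset.sum_congr rfl fun i _ => ?_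
      have hsingle : (Pi.single i 1 : ι → ℝ) = fun j => if i = j then 1 else 0 :=
        funext fun j => by simp [Pi.single_apply, eq_comm]
      rw [mul_comm, smul_eq_mul, hsingle]
      rfl
    have hLh : L h = f c := by
      rw [hL, ← hc, map_sum]
      refine Finset.sum_congr rfl fun j _ => ?_
      rw [hzθ, map_smul, map_smul, hh, smul_eq_mul, smul_eq_mul]
    have hu : L g * ‖h‖ ≤ u := by
      rcases hs0.eq_or_lt with h0 | h0
      · have := hfu 0 ⟨0, zero_mem_featureHull K, by simp⟩
        rw [map_zero] at this
        rw [← h0, zero_mul]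
        exact this.le
      rw [← le_div_iff₀' h0]
      refine ZeroAtInftyContinuousMap.norm_le_of_forall_abs_le fun θ => ?_
      have habs : L g * |h θ| = |L g * h θ| := by rw [abs_mul, abs_of_pos h0]
      rw [le_div_iff₀' h0, habs, hh, abs_le']
      constructor
      · have := hfu _ ⟨_, smul_mem_featureHull K (ε := 1) (by simp) θ, rfl⟩
        simpa using this.le
      · have := hfu _ ⟨_, smul_mem_featureHull K (ε := -1) (by simp) θ, rfl⟩
        simpa using this.le
    linarith [hLle h hhV]
  have hLg : 1 ≤ L g := not_lt.1 fun hlt => hmin _ hs0 hlt hmem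
  have hone : ∀ j, ε j * g (θ j) = 1 := by
    have hsum : ∑ j, w j * (1 - ε j * g (θ j)) ≤ 0 := by
      simp only [mul_sub, mul_one, Finset.sum_sub_distrib, hw1]
      linarith [hL g]
    have hnn : ∀ j ∈ Finset.univ, 0 ≤ w j * (1 - ε j * g (θ j)) := fun j _ =>
      mul_nonneg (hw j).le (sub_nonneg.2 (hεg g j hg1))
    intro j
    have := (Finset.sum_eq_zero_iff_of_nonneg hnn).1
      (hsum.antisymm (Finset.sum_nonneg hnn)) j (Finset.mem_univ j)
    rcases mul_eq_zero.1 this with h | h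
    · exact absurd h (hw j).ne'
    · linarith
  have habs : ∀ j, |g (θ j)| = 1 := fun j => by
    have h1 := (g.abs_apply_le_norm (θ j)).trans hg1
    have h2 : |ε j| * |g (θ j)| = 1 := by rw [← abs_mul, hone, abs_one]
    have h3 := abs_le.2 (hε j)
    nlinarith [abs_nonneg (g (θ j))]
  have hsign : ∀ j, Real.sign (g (θ j)) = ε j := fun j => by
    have h1 := hone j
    rcases eq_or_eq_neg_of_abs_eq (habs j) with h | h <;> rw [h] at h1 ⊢
    · rw [Real.sign_one]; linarith
    · rw [Real.sign_neg, Real.sign_one]; linarith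
  have hlin : LinearIndependent ℝ z := by
    obtain ⟨a, ha⟩ := (Submodule.mem_span_range_iff_exists_fun ℝ).1 hgV
    have hpair : ∀ j, ∑ i, a i * z j i = 1 := fun j => by
      rw [← hone j, ← ha, hzθ, ZeroAtInftyContinuousMap.sum_smul_apply, Finset.mul_sum]
      exact Finset.sum_congr rfl fun i _ => mul_left_comm _ _ _
    rw [Fintype.linearIndependent_iff]
    intro b hb j
    refine affineIndependent_iff.1 hind Finset.univ b ?_ hb j (Finset.mem_univ j)
    calc ∑ j, b j = ∑ j, b j * ∑ i, a i * z j i := by simp [hpair]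
      _ = ∑ i, a i * (∑ j, b j • z j) i := by
        simp only [Finset.mul_sum, Finset.sum_apply, Pi.smul_apply, smul_eq_mul]
        rw [Finset.sum_comm]
        exact Finset.sum_congr rfl fun _ _ => Finset.sum_congr rfl fun _ _ => by ring
      _ = 0 := by rw [hb]; simp
  have hcard : Fintype.card J ≤ Fintype.card κ := by
    simpa [hκ] using hlin.fintype_card_le_finrank
  obtain ⟨e⟩ := Function.Embedding.nonempty_of_card_le hcard
  obtain ⟨j₀⟩ : Nonempty J := by
    by_contra hJ
    rw [not_nonempty_iff] at hJ
    simp at hw1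
  have hextw : ∀ j, Function.extend e w 0 (e j) = w j := e.injective.extend_apply w 0
  have hextθ : ∀ j, Function.extend e θ (fun _ => θ j₀) (e j) = θ j := e.injective.extend_apply θ _
  have hout : ∀ k ∉ Set.range e, Function.extend e w 0 k = 0 := fun k hk =>
    Function.extend_apply' _ _ _ hk
  refine ⟨g, hgV, hg1.antisymm ((habs j₀).symm.trans_le (g.abs_apply_le_norm _)),
    Function.extend e w 0, Function.extend e θ fun _ => θ j₀, fun k => ?_, ?_, fun k => ?_,
    fun i => ?_⟩
  · by_cases hk : k ∈ Set.range e
    · obtain ⟨j, rfl⟩ := hk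
      rw [hextw]
      exact (hw j).le
    · rw [hout k hk]
  · rw [← hw1]
    exact (Fintype.sum_of_injective e e.injective _ _ hout fun j => (hextw j).symm).symm
  · by_cases hk : k ∈ Set.range e
    · obtain ⟨j, rfl⟩ := hk
      rw [hextθ]
      exact habs j
    · rw [Function.extend_apply' _ _ _ hk]
      exact habs j₀
  · rw [← hc, Finset.sum_apply]
    refine (Fintype.sum_of_injective e e.injective _ _ (fun k hk => by simp [hout k hk])
      fun j => ?_).symm
    rw [hextw, hextθ, hsign, hzθ]
    simp [mul_assoc]

end PeakFunction

section Regularization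

open scoped Pointwise

theorem IsCompact.isClosed_setOf_mem_smul {E : Type*} [NormedAddCommGroup E] [NormedSpace ℝ E]
    {C : Set E} (hC : IsCompact C) (y : E) : IsClosed {r : ℝ | y ∈ r • C} := by
  have : CompactSpace C := isCompact_iff_compactSpace.1 hC
  have hcl : IsClosed {p : ℝ × C | p.1 • (p.2 : E) = y} :=
    isClosed_eq (by fun_prop) continuous_const
  convert isClosedMap_fst_of_compactSpace _ hcl using 1
  ext r
  simp [Set.mem_smul_set]

theorem exists_forall_le_add_mul_of_isCompact {E : Type*} [NormedAddCommGroup E]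
    [NormedSpace ℝ E] {C : Set E} (hC : IsCompact C) (hne : C.Nonempty) {q : E → ℝ}
    (hq0 : ∀ z, 0 ≤ q z) (hq : LowerSemicontinuous q) {lam : ℝ} (hlam : 0 < lam) :
    ∃ r : ℝ, 0 ≤ r ∧ ∃ c ∈ C, ∀ r' : ℝ, 0 ≤ r' → ∀ c' ∈ C,
      q (r • c) + lam * r ≤ q (r' • c') + lam * r' := by
  have hF : LowerSemicontinuous fun p : ℝ × E => q (p.1 • p.2) + lam * p.1 :=
    (LowerSemicontinuous.comp hq (by fun_prop : Continuous fun p : ℝ × E => p.1 • p.2)).add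
      (by fun_prop : Continuous fun p : ℝ × E => lam * p.1).lowerSemicontinuous
  have hR : 0 ≤ q 0 / lam := div_nonneg (hq0 0) hlam.le
  obtain ⟨c₀, hc₀⟩ := hne
  obtain ⟨⟨r, c⟩, ⟨hr, hc⟩, hmin⟩ := LowerSemicontinuousOn.exists_isMinOn
    (⟨(0, c₀), ⟨le_rfl, hR⟩, hc₀⟩ : (Set.Icc 0 (q 0 / lam) ×ˢ C).Nonempty)
    (isCompact_Icc.prod hC) (hF.lowerSemicontinuousOn _)
  refine ⟨r, hr.1, c, hc, fun r' hr' c' hc' => ?_⟩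
  rcases le_total r' (q 0 / lam) with h | h
  · exact hmin (show (r', c') ∈ _ from ⟨⟨hr', h⟩, hc'⟩)
  · have h0 := hmin (show ((0 : ℝ), c₀) ∈ _ from ⟨⟨le_rfl, hR⟩, hc₀⟩)
    simp only [Set.mem_ofPred_eq, zero_smul, mul_zero, add_zero] at h0
    rw [div_le_iff₀' hlam] at h
    linarith [hq0 (r' • c')]

theorem exists_signedMeasure_of_mem_featureHull {Θ ι : Type*} [TopologicalSpace Θ]
    [MeasurableSpace Θ] [OpensMeasurableSpace Θ] (K : ι → C₀(Θ, ℝ)) {c : ι → ℝ}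
    (hc : c ∈ featureHull K) {r : ℝ} (hr : 0 ≤ r) :
    ∃ μ : SignedMeasure Θ, tvNorm μ ≤ r ∧ (fun i => sInt μ (K i)) = r • c := by
  obtain ⟨J, _, z, w, hz, -, hw, hw1, rfl⟩ := eq_pos_convex_span_of_mem_convexHull hc
  choose ε hε θ hzθ using fun j => hz ⟨j, rfl⟩
  obtain ⟨μ, hμ, hint⟩ := exists_signedMeasure_sum_dirac (fun j => r * w j * ε j) θ
  refine ⟨μ, hμ.trans ?_, funext fun i => ?_⟩
  · calc ∑ j, |r * w j * ε j| ≤ ∑ j, r * w j := Finset.sum_le_sum fun j _ => by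
          have h := mul_nonneg hr (hw j).le
          rw [abs_mul, abs_of_nonneg h]
          exact mul_le_of_le_one_right h (abs_le.2 (hε j))
      _ = r := by rw [← Finset.mul_sum, hw1, mul_one]
  · rw [hint (K i) (map_continuous (K i)).measurable ⟨‖K i‖, (K i).abs_apply_le_norm⟩]
    simp only [Pi.smul_apply, Finset.sum_apply, smul_eq_mul, Finset.mul_sum, hzθ]
    exact Finset.sum_congr rfl fun j _ => by ring

theorem tvNorm_nonneg {Θ : Type*} [MeasurableSpace Θ] (μ : SignedMeasure Θ) : 0 ≤ tvNorm μ :=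
  ENNReal.toReal_nonneg

variable (σ : ℝ → ℝ) (m : ℕ → ℕ) (D : ℕ) (ρ : Params m D → ℝ)

theorem BNnorm_nonneg (f : (Fin (m 0) → ℝ) → Fin (m D) → ℝ) : 0 ≤ BNnorm σ m D ρ f :=
  Real.sInf_nonneg fun _ ⟨μ, _, h⟩ => h ▸ tvNorm_nonneg μ

theorem BNnorm_fMu_le (μ : SignedMeasure (Params m D)) :
    BNnorm σ m D ρ (fMu σ m D ρ μ) ≤ tvNorm μ :=
  csInf_le ⟨0, fun _ ⟨ν, _, h⟩ => h ▸ tvNorm_nonneg ν⟩ ⟨μ, rfl, rfl⟩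

theorem exists_BNnorm_smul_eq {ι : Type*} [Fintype ι] (K : ι → C₀(Params m D, ℝ))
    (I : ((Fin (m 0) → ℝ) → Fin (m D) → ℝ) → ι → ℝ)
    (hI : ∀ μ, I (fMu σ m D ρ μ) = fun i => sInt μ (K i)) (μ : SignedMeasure (Params m D)) :
    ∃ c ∈ featureHull K, BNnorm σ m D ρ (fMu σ m D ρ μ) • c = I (fMu σ m D ρ μ) := by
  refine Set.mem_smul_set.1 (closure_minimal ?_
    ((isCompact_featureHull K).isClosed_setOf_mem_smul (I (fMu σ m D ρ μ)))
    (csInf_mem_closure (Set.Nonempty.image _ ⟨μ, rfl⟩)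
      ⟨0, fun _ ⟨ν, _, h⟩ => h ▸ tvNorm_nonneg ν⟩))
  rintro _ ⟨ν, hν, rfl⟩
  have h := sInt_mem_smul_featureHull K ν
  rw [← hI, show fMu σ m D ρ ν = fMu σ m D ρ μ from hν] at h
  exact h

end Regularization

/-- If `λ > 0`, the loss `Q` is lower semi-continuous and
`D_{X,Y} ≠ {0}`, the regularization problem has a solution of the form
`f̂(x) = ∑_{ℓ=1}^{tm} γ_ℓ sign(ĝ(θ_ℓ)) K(x,θ_ℓ)` for some nonzero `ĝ ∈ V_N`,
`∑ γ_ℓ = ‖ĝ‖_∞`, and `θ_ℓ ∈ Θ(ĝ)`, where `K(x,θ) = N(x,θ)ρ(θ)`. -/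
theorem statement_19
    (σ : ℝ → ℝ) (hσ : Continuous σ) (m : ℕ → ℕ) (D : ℕ) (hD : 0 < D)
    (ρ : Params m D → ℝ) (hρc : Continuous ρ) (hρpos : ∀ θ, 0 < ρ θ)
    (Kb : (Fin (m 0) → ℝ) → Fin (m D) → C₀(Params m D, ℝ))
    (hKb : ∀ x k θ, Kb x k θ = NNet σ m D θ x k * ρ θ)
    (M : ℕ) (x : Fin M → (Fin (m 0) → ℝ)) (hx : Function.Injective x)
    (Y : Fin (m D) → Fin M → ℝ) (lam : ℝ) (hlam : 0 < lam)
    (Q : (Fin (m D) → Fin M → ℝ) → ℝ) (hQ0 : ∀ z, 0 ≤ Q z)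
    (hQl : LowerSemicontinuous Q)
    (hDXY : DXY σ m D ρ M x Y lam Q ≠ {0}) :
    ∃ f ∈ RegSolSet σ m D ρ M x Y lam Q, ∃ g : C₀(Params m D, ℝ),
      g ∈ VN m D Kb M x ∧ g ≠ 0 ∧
      ∃ (γ : Fin (m D * M) → ℝ) (θs : Fin (m D * M) → Params m D),
        (∑ ℓ, γ ℓ) = ‖g‖
        ∧ (∀ ℓ, θs ℓ ∈ ThetaSet m D g)
        ∧ ∀ (x' : Fin (m 0) → ℝ) (k : Fin (m D)),
            f x' k = ∑ ℓ, γ ℓ * Real.sign (g (θs ℓ)) *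
              (NNet σ m D (θs ℓ) x' k * ρ (θs ℓ)) := by
  classical
  let K : Fin (m D) × Fin M → C₀(Params m D, ℝ) := fun p => Kb (x p.2) p.1
  let I : ((Fin (m 0) → ℝ) → Fin (m D) → ℝ) → Fin (m D) × Fin M → ℝ := fun f p => f (x p.2) p.1
  let q : (Fin (m D) × Fin M → ℝ) → ℝ := fun z => Q ((fun k j => z (k, j)) - Y)
  let C := featureHull K
  have hI : ∀ μ, I (fMu σ m D ρ μ) = fun p => sInt μ (K p) := fun μ => funext fun p =>
    congrArg (sInt μ) (funext fun θ => (hKb _ _ θ).symm)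
  have hobj : ∀ f, regObj σ m D ρ M x Y lam Q f = q (I f) + lam * BNnorm σ m D ρ f :=
    fun _ => rfl
  have hq : LowerSemicontinuous q := LowerSemicontinuous.comp hQl (by fun_prop)
  have hC : IsCompact C := isCompact_featureHull K
  have hnorm_mem := exists_BNnorm_smul_eq σ m D ρ K I hI
  let IsMinimizer (r : ℝ) (c : Fin (m D) × Fin M → ℝ) : Prop := ∀ r' : ℝ, 0 ≤ r' → ∀ c' ∈ C,
    q (r • c) + lam * r ≤ q (r' • c') + lam * r'
  have hsol : ∀ r c, IsMinimizer r c → ∀ μ, tvNorm μ ≤ r → I (fMu σ m D ρ μ) = r • c →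
      fMu σ m D ρ μ ∈ RegSolSet σ m D ρ M x Y lam Q := fun r c hmin μ hμ hIμ => by
    refine ⟨⟨μ, rfl⟩, fun ν => ?_⟩
    obtain ⟨c', hc', h⟩ := hnorm_mem ν
    have h1 := hmin _ (BNnorm_nonneg σ m D ρ (fMu σ m D ρ ν)) c' hc'
    rw [hobj, hobj, hIμ, ← h]
    have h2 := mul_le_mul_of_nonneg_left ((BNnorm_fMu_le σ m D ρ μ).trans hμ) hlam.le
    exact (add_le_add_right h2 _).trans h1
  have hrep : ∀ r c, 0 ≤ r → c ∈ C → IsMinimizer r c → r • c ≠ 0 →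
      ∃ f ∈ RegSolSet σ m D ρ M x Y lam Q, ∃ g : C₀(Params m D, ℝ),
      g ∈ VN m D Kb M x ∧ g ≠ 0 ∧
      ∃ (γ : Fin (m D * M) → ℝ) (θs : Fin (m D * M) → Params m D),
        (∑ ℓ, γ ℓ) = ‖g‖
        ∧ (∀ ℓ, θs ℓ ∈ ThetaSet m D g)
        ∧ ∀ (x' : Fin (m 0) → ℝ) (k : Fin (m D)),
            f x' k = ∑ ℓ, γ ℓ * Real.sign (g (θs ℓ)) *
              (NNet σ m D (θs ℓ) x' k * ρ (θs ℓ)) := by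
    intro r c hr hc hmin hne
    have hrpos : 0 < r := hr.lt_of_ne fun h => hne (by rw [← h, zero_smul])
    obtain ⟨g, hgV, hg1, w, θ, hw, hw1, hgθ, hwc⟩ := exists_peak_function
      (κ := Fin (m D * M)) (by simp) K hc fun s hs0 hs1 hcs => by
        obtain ⟨c', hc', rfl⟩ := hcs
        have h := hmin (r * s) (mul_nonneg hr hs0) c' hc'
        simp only [smul_smul] at h
        nlinarith [mul_pos hlam hrpos]
    obtain ⟨μ, hμ, hint⟩ := exists_signedMeasure_sum_dirac
      (fun ℓ => r * w ℓ * Real.sign (g (θ ℓ))) θ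
    have hsInt : ∀ x' k, fMu σ m D ρ μ x' k =
        ∑ ℓ, r * w ℓ * Real.sign (g (θ ℓ)) * Kb x' k (θ ℓ) := fun x' k => by
      rw [← hint (Kb x' k) (map_continuous (Kb x' k)).measurable ⟨_, (Kb x' k).abs_apply_le_norm⟩]
      exact congrArg (sInt μ) (funext fun θ => (hKb _ _ θ).symm)
    have hsign : ∀ ℓ, Real.sign ((r • g) (θ ℓ)) = Real.sign (g (θ ℓ)) := fun ℓ => by
      rw [ZeroAtInftyContinuousMap.smul_apply, smul_eq_mul]
      rcases eq_or_eq_neg_of_abs_eq (hgθ ℓ) with h | h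
      · rw [h, mul_one, Real.sign_of_pos hrpos, Real.sign_one]
      · rw [h, mul_neg_one, Real.sign_neg, Real.sign_of_pos hrpos, Real.sign_neg, Real.sign_one]
    have habs : ∀ ℓ, |Real.sign (g (θ ℓ))| = 1 := fun ℓ => by
      rcases eq_or_eq_neg_of_abs_eq (hgθ ℓ) with h | h <;> simp [h, Real.sign_neg]
    have hnorm : ‖r • g‖ = r := by rw [norm_smul, hg1, mul_one, Real.norm_of_nonneg hr]
    refine ⟨fMu σ m D ρ μ, hsol r c hmin μ (hμ.trans_eq ?_) (funext fun p => ?_), r • g,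
      Submodule.smul_mem _ _ hgV, fun h => ?_, fun ℓ => r * w ℓ, θ, ?_, fun ℓ => ?_,
      fun x' k => ?_⟩
    · simp only [abs_mul, habs, mul_one, abs_of_nonneg hr, abs_of_nonneg (hw _)]
      rw [← Finset.mul_sum, hw1, mul_one]
    · rw [Pi.smul_apply, ← hwc p, smul_eq_mul, Finset.mul_sum]
      refine (hsInt _ _).trans (Finset.sum_congr rfl fun ℓ _ => ?_)
      simp only [K]
      ring
    · rw [h, norm_zero] at hnorm
      exact hrpos.ne hnorm
    · rw [← Finset.mul_sum, hw1, mul_one, hnorm]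
    · change |(r • g) (θ ℓ)| = ‖r • g‖
      rw [hnorm, ZeroAtInftyContinuousMap.smul_apply, smul_eq_mul, abs_mul, hgθ, mul_one,
        abs_of_nonneg hr]
    · simp only [hsInt, hsign, hKb]
  obtain ⟨r, hr, c, hc, hmin⟩ := exists_forall_le_add_mul_of_isCompact hC
    ⟨0, zero_mem_featureHull K⟩ (fun z => hQ0 _) hq hlam
  by_cases hrc : r • c = 0
  swap
  · exact hrep r c hr hc hmin hrc
  obtain ⟨μ, hμr, hμ⟩ := exists_signedMeasure_of_mem_featureHull K hc hr
  have hμsol := hsol r c hmin μ hμr ((hI μ).trans hμ)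
  obtain ⟨f, hf, hIf⟩ : ∃ f ∈ RegSolSet σ m D ρ M x Y lam Q, I f ≠ 0 := by
    by_contra! hall
    refine hDXY (Set.eq_singleton_iff_unique_mem.2 ⟨⟨_, hμsol, ?_⟩, ?_⟩)
    · exact funext fun k => funext fun j => congrFun (hall _ hμsol) (k, j)
    · rintro _ ⟨f, hf, rfl⟩
      exact funext fun k => funext fun j => congrFun (hall _ hf) (k, j)
  obtain ⟨⟨ν, rfl⟩, hopt⟩ := hf
  obtain ⟨c', hc', h⟩ := hnorm_mem ν
  refine hrep _ c' (BNnorm_nonneg σ m D ρ _) hc' (fun r₁ hr₁ c₁ hc₁ => ?_) (by rwa [← h] at hIf)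
  have h1 := hopt μ
  rw [hobj, hobj, ← h, hI μ, hμ] at h1
  have h2 := mul_le_mul_of_nonneg_left ((BNnorm_fMu_le σ m D ρ μ).trans hμr) hlam.le
  exact (h1.trans (add_le_add_right h2 _)).trans (hmin r₁ hr₁ c₁ hc₁)

end
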